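/- Both a_3' and a_3'' send the relations 2) (skew-symmetry in the l's and in the m's), 3) (additivity and dual additivity in L and in M), and 4) (projective invariance) defining A_3(F) to zero in B_3(F) ⊗ ℚ, whenever all the terms occurring are generic. -/

import Mathlib

noncomputable section
open scoped TensorProduct
open Classical

namespace Gon

variable (F : Type) [Field F]

/-- Points of the projective space `P^{d-1}(F)`, i.e. lines in `F^d`. -/
abbrev Pt (d : ℕ) := Projectivization F (Fin d → F)

variable {F}

/-- Determinant of a `d`-tuple of vectors in `F^d` (w.r.t. the standard volume form). -/
def dt {d : ℕ} (v : Fin d → (Fin d → F)) : F := Matrix.det (Matrix.of v)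

/-- `Δ` of three vectors of `F^3`. -/
def det3 (a b c : Fin 3 → F) : F := dt ![a, b, c]

/-- `Δ` of four vectors of `F^4`. -/
def det4 (a b c d : Fin 4 → F) : F := dt ![a, b, c, d]

/-- Cross-ratio of four points on the projective line. -/
def cr1 (a b c d : Pt F 2) : F :=
  (dt ![a.rep, c.rep] * dt ![b.rep, d.rep]) / (dt ![a.rep, d.rep] * dt ![b.rep, c.rep])

/-- Cross-ratio of the four points of `P^1` obtained by projecting `a b c d` from the
centre `e` in the projective plane. -/
def crFrom3 (e a b c d : Pt F 3) : F :=
  (det3 e.rep a.rep c.rep * det3 e.rep b.rep d.rep) /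
    (det3 e.rep a.rep d.rep * det3 e.rep b.rep c.rep)

/-- Cross-ratio of the four points of `P^1` obtained by projecting `a b c d` from the
line through `p` and `q` in `P^3`. -/
def crLine (p q a b c d : Pt F 4) : F :=
  (det4 p.rep q.rep a.rep c.rep * det4 p.rep q.rep b.rep d.rep) /
    (det4 p.rep q.rep a.rep d.rep * det4 p.rep q.rep b.rep c.rep)

variable (F)

/-- `ℚ[F]`, the free `ℚ`-vector space on the set `F`. -/
abbrev QF := F →₀ ℚ

variable {F}

/-- The generator `{x}` of `ℚ[F]`, with the convention `{0} = {∞} = 0`. -/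
def gen (a : F) : QF F := if a = 0 then 0 else Finsupp.single a 1

/-- Make a projective point out of a vector, with a junk value at `0`. -/
def mkPt {d : ℕ} (v : Fin (d + 1) → F) : Pt F (d + 1) :=
  if h : v ≠ 0 then Projectivization.mk F v h
  else Projectivization.mk F (fun _ => 1) (by
    intro h0; have := congrFun h0 0; simp at this)

/-- Projection of a point `x` of `P^{N-1}` from the centre spanned by the points `c`,
to `P^d` (realized via an arbitrarily chosen identification of the quotient space with
`F^{d+1}`; the resulting configurations are well defined up to projective equivalence). -/
def projection {N : ℕ} (d : ℕ) {k : ℕ} (c : Fin k → Pt F N) (x : Pt F N) : Pt F (d + 1) :=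
  let W : Submodule F (Fin N → F) := Submodule.span F (Set.range fun i => (c i).rep)
  if h : Module.finrank F ((Fin N → F) ⧸ W) = d + 1 then
    mkPt (((Module.finBasis F ((Fin N → F) ⧸ W)).reindex (finCongr h)).equivFun
      (Submodule.Quotient.mk x.rep))
  else mkPt 0

/-- The action of `GL(F^N)` on `P^{N-1}(F)`. -/
def mapPt {N : ℕ} (g : (Fin N → F) ≃ₗ[F] (Fin N → F)) (x : Pt F N) : Pt F N :=
  Projectivization.map g.toLinearMap g.injective x

/-- The five term element of `ℚ[F]` attached to five points of the projective line. -/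
def fiveTerm (x : Fin 5 → Pt F 2) : QF F :=
  ∑ i : Fin 5, ((-1 : ℤ) ^ (i : ℕ)) •
    gen (cr1 (x (i.succAbove 0)) (x (i.succAbove 1)) (x (i.succAbove 2)) (x (i.succAbove 3)))

variable (F)

/-- `R_2(F)`: the five-term relations for five distinct points of `P^1(F)`, together with
`{1}` (the generators of `ℤ[F^* ∖ {1}]` omit `1`). -/
def R2 : Submodule ℚ (QF F) :=
  Submodule.span ℚ
    ({z | ∃ x : Fin 5 → Pt F 2, Function.Injective x ∧ z = fiveTerm x} ∪ {gen (1 : F)})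

/-- The Bloch group `B_2(F)` (tensored with `ℚ`). -/
abbrev B2 := QF F ⧸ R2 F

def clsB2 : QF F →ₗ[ℚ] B2 F := (R2 F).mkQ

/-- `{x}_2 ∈ B_2(F)`. -/
def b2 (a : F) : B2 F := clsB2 F (gen a)

variable {F}

variable (F)

/-- triple ratio of six points of the plane. -/
def tripleRatio (x : Fin 6 → Pt F 3) : F :=
  (det3 (x 0).rep (x 1).rep (x 3).rep * det3 (x 1).rep (x 2).rep (x 4).rep *
      det3 (x 2).rep (x 0).rep (x 5).rep) /
    (det3 (x 0).rep (x 1).rep (x 4).rep * det3 (x 1).rep (x 2).rep (x 5).rep *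
      det3 (x 2).rep (x 0).rep (x 3).rep)

variable {F}

/-- The generalized cross-ratio `r_3` of six points of `P^2` in generic position:
`r_3(x_1,...,x_6) = (1/15)·Alt_6 {triple ratio}`, as an element of `ℚ[F]`. -/
def r3free (x : Fin 6 → Pt F 3) : QF F :=
  (1 / 15 : ℚ) • ∑ σ : Equiv.Perm (Fin 6), (Equiv.Perm.sign σ : ℤ) • gen (tripleRatio F (x ∘ σ))

/-- Six points of `P^2` are in generic position: no two coincide, no three collinear. -/
def Generic6 (x : Fin 6 → Pt F 3) : Prop :=
  ∀ a b c : Fin 6, a ≠ b → a ≠ c → b ≠ c → det3 (x a).rep (x b).rep (x c).rep ≠ 0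

/-- Kummer's functional equation for the trilogarithm. -/
def kummer (x y : F) : QF F :=
  -gen (x * (1 - y) ^ 2 / (y * (1 - x) ^ 2)) - gen (x * y) - gen (x / y) - (2 : ℚ) • gen 1 +
    (2 : ℚ) • (gen (-x * (1 - y) / (1 - x)) + gen (x * (1 - y) / (y * (1 - x))) +
      gen (-y * (1 - x) / (1 - y)) + gen ((1 - x) / (1 - y)) + gen y + gen x)

variable (F)

/-- `R_3(F)`: generated by `{x} - {x⁻¹}`, the seven term relations for seven generic
points of the plane, and Kummer's relations. -/
def R3 : Submodule ℚ (QF F) :=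
  Submodule.span ℚ
    ({z | ∃ x : F, z = gen x - gen x⁻¹} ∪
      {z | ∃ x : Fin 7 → Pt F 3, (∀ i j k : Fin 7, i ≠ j → i ≠ k → j ≠ k →
          det3 (x i).rep (x j).rep (x k).rep ≠ 0) ∧
          z = ∑ i : Fin 7, ((-1 : ℤ) ^ (i : ℕ)) • r3free (x ∘ i.succAbove)} ∪
      {z | ∃ x y : F, x ≠ 0 ∧ x ≠ 1 ∧ y ≠ 0 ∧ y ≠ 1 ∧ z = kummer x y})

/-- `B_3(F)` (tensored with `ℚ`). -/
abbrev B3 := QF F ⧸ R3 F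

def clsB3 : QF F →ₗ[ℚ] B3 F := (R3 F).mkQ

/-- `{x}_3 ∈ B_3(F)`. -/
def b3 (a : F) : B3 F := clsB3 F (gen a)

variable {F}

/-- `μ_3`, relative to a given cross-ratio function `cr` (18 terms, with the factor 1/4):
`μ_3(x_1,x_2,x_3;y_1,y_2,y_3) = (1/4)·Alt_{(x)(y)}({r(x_1,y_2,x_2,y_1)} - {r(x_1,y_1,x_2,y_2)})`. -/
def mu3 {P : Type} (cr : P → P → P → P → F) (x y : Fin 3 → P) : QF F :=
  (1 / 4 : ℚ) • ∑ σ : Equiv.Perm (Fin 3), ∑ τ : Equiv.Perm (Fin 3),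
    (((Equiv.Perm.sign σ : ℤ) * (Equiv.Perm.sign τ : ℤ)) : ℤ) •
      (gen (cr (x (σ 0)) (y (τ 1)) (x (σ 1)) (y (τ 0))) -
        gen (cr (x (σ 0)) (y (τ 0)) (x (σ 1)) (y (τ 1))))

/-- triple ratio of the configuration of six points of `P^2` obtained by projecting the
six points `z` of `P^3` from the centre `e`. -/
def tripleRatioFrom4 (e : Pt F 4) (z : Fin 6 → Pt F 4) : F :=
  (det4 e.rep (z 0).rep (z 1).rep (z 3).rep * det4 e.rep (z 1).rep (z 2).rep (z 4).rep *
      det4 e.rep (z 2).rep (z 0).rep (z 5).rep) /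
    (det4 e.rep (z 0).rep (z 1).rep (z 4).rep * det4 e.rep (z 1).rep (z 2).rep (z 5).rep *
      det4 e.rep (z 2).rep (z 0).rep (z 3).rep)

/-- `r_3` of the configuration of six points of `P^2` obtained by projection from `e ∈ P^3`. -/
def r3From4 (e : Pt F 4) (z : Fin 6 → Pt F 4) : QF F :=
  (1 / 15 : ℚ) • ∑ σ : Equiv.Perm (Fin 6), (Equiv.Perm.sign σ : ℤ) •
    gen (tripleRatioFrom4 e (z ∘ σ))

/-- `a_3'(l_0,...,l_3;m_0,...,m_3) = Σ_{i,j} (-1)^{i+j} r_3(l_i | l̂_i; m̂_j)`. -/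
def a3p (l m : Fin 4 → Pt F 4) : QF F :=
  ∑ i : Fin 4, ∑ j : Fin 4, ((-1 : ℤ) ^ ((i : ℕ) + (j : ℕ))) •
    r3From4 (l i) ![l (i.succAbove 0), l (i.succAbove 1), l (i.succAbove 2),
      m (j.succAbove 0), m (j.succAbove 1), m (j.succAbove 2)]

/-- `a_3''(l_0,...,l_3;m_0,...,m_3) = Σ_{i,j} (-1)^{i+j} μ_3(l_i,m_j | l̂_i; m̂_j)`,
the cross-ratios being taken after projection from the line through `l_i` and `m_j`. -/
def a3pp (l m : Fin 4 → Pt F 4) : QF F :=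
  ∑ i : Fin 4, ∑ j : Fin 4, ((-1 : ℤ) ^ ((i : ℕ) + (j : ℕ))) •
    mu3 (crLine (l i) (m j)) (l ∘ i.succAbove) (m ∘ j.succAbove)

/-- `a_3 = (1/6)·a_3' - (1/3)·a_3''` (at the level of `ℚ[F]`). -/
def a3free (l m : Fin 4 → Pt F 4) : QF F :=
  (1 / 6 : ℚ) • a3p l m - (1 / 3 : ℚ) • a3pp l m

/-- A pair of tetrahedra in `P^3` is in generic position when any four of the eight
vertices are projectively independent. -/
def GenericPair (l m : Fin 4 → Pt F 4) : Prop :=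
  ∀ a b c d : Fin 8, a ≠ b → a ≠ c → a ≠ d → b ≠ c → b ≠ d → c ≠ d →
    det4 ((Fin.append l m a).rep) ((Fin.append l m b).rep)
      ((Fin.append l m c).rep) ((Fin.append l m d).rep) ≠ 0

section AlternatingSums

variable {P M : Type} [AddCommGroup M]

/-- The alternating sum over all ways of removing one point `p` from a tuple `l`, of `G p x`,
`x` being the tuple of remaining points. -/
def altSum {n : ℕ} (G : P → (Fin n → P) → M) (l : Fin (n + 1) → P) : M :=
  ∑ i : Fin (n + 1), ((-1 : ℤ) ^ (i : ℕ)) • G (l i) (l ∘ i.succAbove)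

lemma altSum_congr {n : ℕ} {G H : P → (Fin n → P) → M} {l : Fin (n + 1) → P}
    (h : ∀ i, G (l i) (l ∘ i.succAbove) = H (l i) (l ∘ i.succAbove)) :
    altSum G l = altSum H l :=
  Finset.sum_congr rfl fun i _ => by rw [h i]

lemma altSum_neg {n : ℕ} (G : P → (Fin n → P) → M) (l : Fin (n + 1) → P) :
    altSum (fun p x => -G p x) l = -altSum G l := by
  simp [altSum]

lemma altSum_zero {n : ℕ} (l : Fin (n + 1) → P) :
    altSum (fun _ (_ : Fin n → P) => (0 : M)) l = 0 := by
  simp [altSum]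

lemma altSum_comm {n k : ℕ} (G : P → (Fin n → P) → P → (Fin k → P) → M)
    (l : Fin (n + 1) → P) (m : Fin (k + 1) → P) :
    altSum (fun p x => altSum (fun q y => G p x q y) m) l =
      altSum (fun q y => altSum (fun p x => G p x q y) l) m := by
  simp only [altSum, Finset.smul_sum]
  rw [Finset.sum_comm]
  exact Finset.sum_congr rfl fun j _ => Finset.sum_congr rfl fun i _ => smul_comm _ _ _

lemma map_altSum {N : Type} [AddCommGroup N] [Module ℚ M] [Module ℚ N] (c : M →ₗ[ℚ] N) {n : ℕ}
    (G : P → (Fin n → P) → M) (l : Fin (n + 1) → P) :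
    c (altSum G l) = altSum (fun p x => c (G p x)) l := by
  simp only [altSum, map_sum, map_zsmul]

/-- Removing two points in the opposite order changes the sign. -/
lemma altSum_altSum_swap {n : ℕ} (H : P → P → (Fin n → P) → M) (l : Fin (n + 2) → P) :
    altSum (fun p x => altSum (fun q y => H p q y) x) l =
      -altSum (fun p x => altSum (fun q y => H q p y) x) l := by
  simp only [altSum, Finset.smul_sum, ← Finset.sum_neg_distrib, smul_smul, ← pow_add,
    Function.comp_apply]
  simp only [← Finset.sum_product', Finset.univ_product_univ]
  refine Finset.sum_bij' (fun a _ => (a.1.succAbove a.2, a.2.predAbove a.1))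
    (fun a _ => (a.1.succAbove a.2, a.2.predAbove a.1)) (by simp) (by simp) ?_ ?_ ?_
  · rintro ⟨i, j⟩ -
    simp [Fin.succAbove_succAbove_predAbove, Fin.predAbove_predAbove_succAbove]
  · rintro ⟨i, j⟩ -
    simp [Fin.succAbove_succAbove_predAbove, Fin.predAbove_predAbove_succAbove]
  · rintro ⟨i, j⟩ -
    have h : (l ∘ (i.succAbove j).succAbove) ∘ (j.predAbove i).succAbove =
        (l ∘ i.succAbove) ∘ j.succAbove := by
      ext k
      simp [Fin.succAbove_succAbove_succAbove_predAbove]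
    simp only [Fin.succAbove_succAbove_predAbove, h, Fin.neg_one_pow_succAbove_add_predAbove,
      neg_smul, neg_neg]

lemma altSum_altSum_eq_zero [Module ℚ M] {n : ℕ} {H : P → P → (Fin n → P) → M}
    {l : Fin (n + 2) → P}
    (h : altSum (fun p x => altSum (fun q y => H p q y) x) l =
      altSum (fun p x => altSum (fun q y => H q p y) x) l) :
    altSum (fun p x => altSum (fun q y => H p q y) x) l = 0 := by
  have h1 := altSum_altSum_swap H l
  rw [← h] at h1
  have : IsAddTorsionFree M := .of_module_rat M
  exact self_eq_neg.mp h1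

/-- An alternating sum over four points changes by the sign under permutations, as soon as the
summand is antisymmetric in the three remaining points. -/
lemma altSum_perm (G : P → (Fin 3 → P) → M)
    (h01 : ∀ p x, G p (x ∘ Equiv.swap 0 1) = -G p x)
    (h12 : ∀ p x, G p (x ∘ Equiv.swap 1 2) = -G p x)
    (l : Fin 4 → P) (σ : Equiv.Perm (Fin 4)) :
    altSum G (l ∘ σ) = (Equiv.Perm.sign σ : ℤ) • altSum G l := by
  have hσ : σ ∈ Submonoid.closure
      (Set.range fun i : Fin 3 => Equiv.swap i.castSucc i.succ) := by
    rw [Equiv.Perm.mclosure_swap_castSucc_succ]; trivial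
  induction hσ using Submonoid.closure_induction generalizing l with
  | one => simp
  | mul a b _ _ ha hb =>
    rw [Equiv.Perm.coe_mul, ← Function.comp_assoc, hb, ha, smul_smul]
    simp [mul_comm]
  | mem x hx =>
    obtain ⟨i, rfl⟩ := hx
    have e01 : ∀ a b c : P, ![b, a, c] = ![a, b, c] ∘ Equiv.swap 0 1 := by
      intro a b c; ext k; fin_cases k <;> simp [Equiv.swap_apply_def]
    have e12 : ∀ a b c : P, ![a, c, b] = ![a, b, c] ∘ Equiv.swap 1 2 := by
      intro a b c; ext k; fin_cases k <;> simp [Equiv.swap_apply_def]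
    have h01' : ∀ p a b c, G p ![b, a, c] = -G p ![a, b, c] := by
      intro p a b c; rw [e01, h01]
    have h12' : ∀ p a b c, G p ![a, c, b] = -G p ![a, b, c] := by
      intro p a b c; rw [e12, h12]
    have hA : ∀ l : Fin 4 → P, altSum G l = G (l 0) ![l 1, l 2, l 3] - G (l 1) ![l 0, l 2, l 3] +
        G (l 2) ![l 0, l 1, l 3] - G (l 3) ![l 0, l 1, l 2] := by
      intro l
      have e : ∀ i : Fin 4, l ∘ i.succAbove =
          ![l (i.succAbove 0), l (i.succAbove 1), l (i.succAbove 2)] := by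
        intro i; ext k; fin_cases k <;> rfl
      refine (Fin.sum_univ_four _).trans ?_
      simp only [e]
      simp [Fin.succAbove]
      abel
    rw [hA, hA, Equiv.Perm.sign_swap (by simp [Fin.ext_iff])]
    fin_cases i
    · simp [Equiv.swap_apply_def]
      rw [h01' (l 2) (l 0) (l 1), h01' (l 3) (l 0) (l 1)]
      abel
    · simp [Equiv.swap_apply_def, Fin.ext_iff]
      rw [h12' (l 3), h01' (l 0) (l 1) (l 2)]
      abel
    · simp [Equiv.swap_apply_def, Fin.ext_iff]
      rw [h12' (l 1), h12' (l 0)]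
      abel

/-- Removing one point from a tuple of three and four points. -/
lemma altSum_three_four (T : P → (Fin 6 → P) → M) (x : Fin 3 → P) (y : Fin 4 → P) :
    altSum T ![x 0, x 1, x 2, y 0, y 1, y 2, y 3] =
      altSum (fun p (z : Fin 2 → P) => T p ![z 0, z 1, y 0, y 1, y 2, y 3]) x -
        altSum (fun p (z : Fin 3 → P) => T p ![x 0, x 1, x 2, z 0, z 1, z 2]) y := by
  have e : ∀ (s : Fin 7 → P) (i : Fin 7), s ∘ i.succAbove =
      ![s (i.succAbove 0), s (i.succAbove 1), s (i.succAbove 2), s (i.succAbove 3),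
        s (i.succAbove 4), s (i.succAbove 5)] := by
    intro s i; ext k; fin_cases k <;> rfl
  have e3 : ∀ i : Fin 3, x ∘ i.succAbove = ![x (i.succAbove 0), x (i.succAbove 1)] := by
    intro i; ext k; fin_cases k <;> rfl
  have e4 : ∀ i : Fin 4, y ∘ i.succAbove =
      ![y (i.succAbove 0), y (i.succAbove 1), y (i.succAbove 2)] := by
    intro i; ext k; fin_cases k <;> rfl
  refine (Fin.sum_univ_seven _).trans ?_
  refine Eq.trans ?_ (congrArg₂ (· - ·) (Fin.sum_univ_three _) (Fin.sum_univ_four _)).symm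
  simp only [e, e3, e4]
  simp [Fin.succAbove]
  abel

end AlternatingSums

section Ratios

variable {P : Type}

/-- The triple ratio of six points relative to a ternary bracket `ψ`. -/
def bracketTripleRatio (ψ : P → P → P → F) (z : Fin 6 → P) : F :=
  (ψ (z 0) (z 1) (z 3) * ψ (z 1) (z 2) (z 4) * ψ (z 2) (z 0) (z 5)) /
    (ψ (z 0) (z 1) (z 4) * ψ (z 1) (z 2) (z 5) * ψ (z 2) (z 0) (z 3))

/-- The generalized cross-ratio of six points relative to a ternary bracket `ψ`. -/
def bracketR3 (ψ : P → P → P → F) (z : Fin 6 → P) : QF F :=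
  (1 / 15 : ℚ) • ∑ σ : Equiv.Perm (Fin 6), (Equiv.Perm.sign σ : ℤ) •
    gen (bracketTripleRatio ψ (z ∘ σ))

/-- The cross-ratio of four points relative to a binary bracket `ψ`. -/
def bracketCr (ψ : P → P → F) (a b c d : P) : F :=
  (ψ a c * ψ b d) / (ψ a d * ψ b c)

lemma sum_sign_smul_mul_left {M : Type} [AddCommGroup M] {n : ℕ}
    (f : Equiv.Perm (Fin n) → M) (τ : Equiv.Perm (Fin n)) :
    ∑ σ : Equiv.Perm (Fin n), (Equiv.Perm.sign σ : ℤ) • f (τ * σ) =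
      (Equiv.Perm.sign τ : ℤ) • ∑ σ : Equiv.Perm (Fin n), (Equiv.Perm.sign σ : ℤ) • f σ := by
  rw [Finset.smul_sum]
  refine Fintype.sum_equiv (Equiv.mulLeft τ) _ _ fun σ => ?_
  rw [smul_smul, Equiv.coe_mulLeft, map_mul, ← Units.val_mul, ← mul_assoc, Int.units_mul_self,
    one_mul]

lemma bracketR3_perm (ψ : P → P → P → F) (z : Fin 6 → P) (τ : Equiv.Perm (Fin 6)) :
    bracketR3 ψ (z ∘ τ) = (Equiv.Perm.sign τ : ℤ) • bracketR3 ψ z := by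
  unfold bracketR3
  rw [smul_comm]
  exact congrArg _ (sum_sign_smul_mul_left (fun σ => gen (bracketTripleRatio ψ (z ∘ σ))) τ)

lemma bracketTripleRatio_congr {ψ φ : P → P → P → F} {z : Fin 6 → P} (s : F) (u : P → F)
    (S : Set P) (hs : s ≠ 0) (hu : ∀ a ∈ S, u a ≠ 0) (hz : ∀ i, z i ∈ S)
    (h : ∀ a ∈ S, ∀ b ∈ S, ∀ c ∈ S, ψ a b c = s * (u a * u b * u c) * φ a b c) :
    bracketTripleRatio ψ z = bracketTripleRatio φ z := by
  have h' := fun i j k => h (z i) (hz i) (z j) (hz j) (z k) (hz k)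
  have hc : s ^ 3 * (u (z 0) ^ 2 * u (z 1) ^ 2 * u (z 2) ^ 2 * u (z 3) * u (z 4) * u (z 5)) ≠ 0 := by
    simp [hs, hu _ (hz _)]
  unfold bracketTripleRatio
  simp only [h']
  rw [← mul_div_mul_left _ (φ (z 0) (z 1) (z 4) * _ * _) hc]
  congr 1 <;> ring

lemma bracketR3_congr {ψ φ : P → P → P → F} {z : Fin 6 → P} (s : F) (u : P → F)
    (S : Set P) (hs : s ≠ 0) (hu : ∀ a ∈ S, u a ≠ 0) (hz : ∀ i, z i ∈ S)
    (h : ∀ a ∈ S, ∀ b ∈ S, ∀ c ∈ S, ψ a b c = s * (u a * u b * u c) * φ a b c) :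
    bracketR3 ψ z = bracketR3 φ z := by
  unfold bracketR3
  refine congrArg _ (Finset.sum_congr rfl fun σ _ => ?_)
  rw [bracketTripleRatio_congr (z := z ∘ σ) s u S hs hu (fun i => hz (σ i)) h]

lemma bracketCr_congr {ψ φ : P → P → F} (s : F) (u : P → F) (S : Set P) (hs : s ≠ 0)
    (hu : ∀ a ∈ S, u a ≠ 0)
    (h : ∀ a ∈ S, ∀ b ∈ S, ψ a b = s * (u a * u b) * φ a b)
    {a b c d : P} (ha : a ∈ S) (hb : b ∈ S) (hc : c ∈ S) (hd : d ∈ S) :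
    bracketCr ψ a b c d = bracketCr φ a b c d := by
  have hk : s ^ 2 * (u a * u b * u c * u d) ≠ 0 := by
    simp [hs, hu, ha, hb, hc, hd]
  unfold bracketCr
  rw [h a ha c hc, h b hb d hd, h a ha d hd, h b hb c hc,
    ← mul_div_mul_left _ (φ a d * _) hk]
  congr 1 <;> ring

lemma mu3_bracketCr_congr {ψ φ : P → P → F} (s : F) (u : P → F) (S : Set P) (hs : s ≠ 0)
    (hu : ∀ a ∈ S, u a ≠ 0)
    (h : ∀ a ∈ S, ∀ b ∈ S, ψ a b = s * (u a * u b) * φ a b)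
    {x y : Fin 3 → P} (hx : ∀ i, x i ∈ S) (hy : ∀ i, y i ∈ S) :
    mu3 (bracketCr ψ) x y = mu3 (bracketCr φ) x y := by
  unfold mu3
  congr 1
  refine Finset.sum_congr rfl fun σ _ => Finset.sum_congr rfl fun τ _ => ?_
  rw [bracketCr_congr s u S hs hu h (hx _) (hy _) (hx _) (hy _),
    bracketCr_congr s u S hs hu h (hx _) (hy _) (hx _) (hy _)]

/-- The part of `mu3` depending on an ordered pair among its first three points. -/
def mu3Pair (cr : P → P → P → P → F) (y : Fin 3 → P) (a b : P) : QF F :=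
  ∑ τ : Equiv.Perm (Fin 3), (Equiv.Perm.sign τ : ℤ) •
    (gen (cr a (y (τ 1)) b (y (τ 0))) - gen (cr a (y (τ 0)) b (y (τ 1))))

lemma mu3_eq_sum_mu3Pair (cr : P → P → P → P → F) (x y : Fin 3 → P) :
    mu3 cr x y = (1 / 4 : ℚ) • ∑ σ : Equiv.Perm (Fin 3), (Equiv.Perm.sign σ : ℤ) •
      mu3Pair cr y (x (σ 0)) (x (σ 1)) := by
  simp only [mu3, mu3Pair, Finset.smul_sum, mul_smul]

lemma mu3_perm_left (cr : P → P → P → P → F) (x y : Fin 3 → P) (τ : Equiv.Perm (Fin 3)) :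
    mu3 cr (x ∘ τ) y = (Equiv.Perm.sign τ : ℤ) • mu3 cr x y := by
  rw [mu3_eq_sum_mu3Pair, mu3_eq_sum_mu3Pair, smul_comm]
  exact congrArg _ (sum_sign_smul_mul_left (fun σ => mu3Pair cr y (x (σ 0)) (x (σ 1))) τ)

/-- The function `mu3` relative to an alternating bracket is unchanged when the two triples are
exchanged. -/
lemma mu3_bracketCr_comm {ψ : P → P → F} (hψ : ∀ a b, ψ b a = -ψ a b) (x y : Fin 3 → P) :
    mu3 (bracketCr ψ) x y = mu3 (bracketCr ψ) y x := by
  have h : ∀ a b c d, bracketCr ψ a b c d = bracketCr ψ d c b a := by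
    intro a b c d
    unfold bracketCr
    rw [hψ a c, hψ b d, hψ a d, hψ b c, neg_mul_neg, neg_mul_neg, mul_comm (ψ a c)]
  have h' : ∀ a b c d, bracketCr ψ a b c d = bracketCr ψ b a d c := by
    intro a b c d
    unfold bracketCr
    rw [mul_comm (ψ a c), mul_comm (ψ a d)]
  unfold mu3
  rw [Finset.sum_comm]
  refine congrArg _ (Finset.sum_congr rfl fun σ _ => Finset.sum_congr rfl fun τ _ => ?_)
  rw [mul_comm, h (x _) (y (σ 1)), h' (x _) (y (σ 0)) (x _)]

lemma mu3_altSum_eq_zero (cr : P → P → P → P → F) (x : Fin 4 → P) (y : Fin 3 → P) :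
    altSum (fun _ z => mu3 cr z y) x = 0 := by
  have huniv : (Finset.univ : Finset (Equiv.Perm (Fin 3))) =
      {1, Equiv.swap 0 1, Equiv.swap 1 2, Equiv.swap 0 2, Equiv.swap 0 1 * Equiv.swap 1 2,
        Equiv.swap 1 2 * Equiv.swap 0 1} := by
    decide
  have h : ∀ z : Fin 3 → P, mu3 cr z y = altSum (fun _ (w : Fin 2 → P) =>
      (1 / 4 : ℚ) • (mu3Pair cr y (w 0) (w 1) - mu3Pair cr y (w 1) (w 0))) z := by
    intro z
    refine Eq.trans ?_ (Fin.sum_univ_three _).symm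
    rw [mu3_eq_sum_mu3Pair, huniv]
    repeat rw [Finset.sum_insert (by decide)]
    rw [Finset.sum_singleton]
    simp only [map_one, map_mul, Equiv.Perm.sign_swap (show (0 : Fin 3) ≠ 1 by decide),
      Equiv.Perm.sign_swap (show (0 : Fin 3) ≠ 2 by decide),
      Equiv.Perm.sign_swap (show (1 : Fin 3) ≠ 2 by decide)]
    simp [Equiv.swap_apply_def, Fin.succAbove, ← smul_add, ← smul_neg]
    abel
  simp only [h]
  exact altSum_altSum_eq_zero rfl

end Ratios

section Projections

lemma dt_map {d : ℕ} (f : (Fin d → F) →ₗ[F] (Fin d → F)) (v : Fin d → Fin d → F) :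
    dt (fun i => f (v i)) = LinearMap.det f * dt v := by
  have h1 : Matrix.of v * (LinearMap.toMatrix' f).transpose = Matrix.of (fun i => f (v i)) := by
    ext i j
    have := congrFun (LinearMap.toMatrix'_mulVec f (v i)) j
    simp [Matrix.mul_apply, ← this, Matrix.mulVec, dotProduct, mul_comm]
  have h2 := congrArg Matrix.det h1
  rw [Matrix.det_mul, Matrix.det_transpose, LinearMap.det_toMatrix'] at h2
  rw [dt, dt, ← h2, mul_comm]

/-- A linear map with one-dimensional kernel spanned by `e` compares determinants with those having
`e` as an additional first vector. -/
lemma exists_dt_comp_eq {d : ℕ} {e : Fin (d + 1) → F} (he : e ≠ 0)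
    (π : (Fin (d + 1) → F) →ₗ[F] (Fin d → F)) (hπ : LinearMap.ker π = F ∙ e) :
    ∃ s : F, s ≠ 0 ∧ ∀ v : Fin d → Fin (d + 1) → F,
      dt (fun i => π (v i)) = s * dt (Matrix.vecCons e v) := by
  obtain ⟨p, hp⟩ := Function.ne_iff.mp he
  let Θ : (Fin (d + 1) → F) →ₗ[F] (Fin (d + 1) → F) :=
    LinearMap.pi (Fin.cons ((e p)⁻¹ • LinearMap.proj p) fun i => LinearMap.proj i ∘ₗ π)
  have hΘ0 : ∀ a, Θ a 0 = (e p)⁻¹ * a p := fun a => by simp [Θ]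
  have hΘs : ∀ a i, Θ a (Fin.succ i) = π a i := fun a i => by simp [Θ]
  have hπe : π e = 0 := by
    rw [← LinearMap.mem_ker, hπ]; exact Submodule.mem_span_singleton_self e
  have hinj : LinearMap.ker Θ = ⊥ := by
    rw [LinearMap.ker_eq_bot']
    intro a ha
    have h1 : π a = 0 := by
      ext i; rw [← hΘs, ha]; rfl
    rw [← LinearMap.mem_ker, hπ, Submodule.mem_span_singleton] at h1
    obtain ⟨c, rfl⟩ := h1
    have h2 := hΘ0 (c • e)
    rw [ha] at h2
    have hp' : e p ≠ 0 := hp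
    simp [hp'] at h2
    simp [h2]
  refine ⟨LinearMap.det Θ, ?_, fun v => ?_⟩
  · exact ((LinearEquiv.ofInjectiveEndo Θ (LinearMap.ker_eq_bot.mp hinj)).isUnit_det').ne_zero
  · rw [← dt_map Θ (Matrix.vecCons e v), dt, dt, Matrix.det_succ_row_zero, Fin.sum_univ_succ,
      Finset.sum_eq_zero]
    · have hp' : e p ≠ 0 := hp
      simp [hΘ0, hp']
      congr 1
    · intro i _
      simp [hΘs, hπe]

lemma dt_smul {d : ℕ} (u : Fin d → F) (v : Fin d → Fin d → F) :
    dt (fun i => u i • v i) = (∏ i, u i) * dt v := by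
  exact Matrix.det_mul_column u (Matrix.of v)

/-- Every point other than the centre is projected to a point represented by its image under a
linear map whose kernel is the centre. -/
lemma exists_projection_rep {d : ℕ} (p : Pt F (d + 2)) :
    ∃ π : (Fin (d + 2) → F) →ₗ[F] (Fin (d + 1) → F), LinearMap.ker π = F ∙ p.rep ∧
      ∀ x, x ≠ p → ∃ u : F, u ≠ 0 ∧ (projection d (fun _ : Fin 1 => p) x).rep = u • π x.rep := by
  have hW : Submodule.span F (Set.range fun _ : Fin 1 => p.rep) = F ∙ p.rep := by
    rw [Set.range_const]
  have hfin : Module.finrank F ((Fin (d + 2) → F) ⧸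
      Submodule.span F (Set.range fun _ : Fin 1 => p.rep)) = d + 1 := by
    have h := Submodule.finrank_quotient_add_finrank
      (Submodule.span F (Set.range fun _ : Fin 1 => p.rep))
    rw [Module.finrank_fin_fun] at h
    have h1 : Module.finrank F (Submodule.span F (Set.range fun _ : Fin 1 => p.rep)) = 1 := by
      rw [hW]; exact finrank_span_singleton p.rep_nonzero
    omega
  let B := ((Module.finBasis F ((Fin (d + 2) → F) ⧸
    Submodule.span F (Set.range fun _ : Fin 1 => p.rep))).reindex (finCongr hfin)).equivFun
  let π : (Fin (d + 2) → F) →ₗ[F] (Fin (d + 1) → F) := B.toLinearMap ∘ₗ Submodule.mkQ _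
  have hker : LinearMap.ker π = F ∙ p.rep := by
    rw [LinearMap.ker_comp_of_ker_eq_bot _ B.ker, Submodule.ker_mkQ, hW]
  refine ⟨π, hker, fun x hx => ?_⟩
  have hne : π x.rep ≠ 0 := by
    intro h0
    rw [← LinearMap.mem_ker, hker, Submodule.mem_span_singleton] at h0
    obtain ⟨c, hc⟩ := h0
    apply hx
    rw [← x.mk_rep, ← p.mk_rep, Projectivization.mk_eq_mk_iff']
    exact ⟨c, hc⟩
  have hproj : projection d (fun _ : Fin 1 => p) x = Projectivization.mk F (π x.rep) hne := by
    unfold projection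
    simp only [dif_pos hfin]
    exact dif_pos hne
  obtain ⟨a, ha⟩ := Projectivization.exists_smul_eq_mk_rep F (π x.rep) hne
  exact ⟨a, a.ne_zero, by rw [hproj, ← ha]; rfl⟩

/-- Determinants of projected points, up to nonzero factors attached to the points. -/
lemma exists_dt_projection_eq {d : ℕ} (p : Pt F (d + 2)) :
    ∃ (s : F) (u : Pt F (d + 2) → F), s ≠ 0 ∧ (∀ x, u x ≠ 0) ∧
      ∀ v : Fin (d + 1) → Pt F (d + 2), (∀ i, v i ≠ p) →
        dt (fun i => (projection d (fun _ : Fin 1 => p) (v i)).rep) =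
          s * (∏ i, u (v i)) * dt (Matrix.vecCons p.rep fun i => (v i).rep) := by
  obtain ⟨π, hker, hπ⟩ := exists_projection_rep p
  obtain ⟨s, hs, h⟩ := exists_dt_comp_eq p.rep_nonzero π hker
  have hu : ∀ x, ∃ u : F, u ≠ 0 ∧
      (x ≠ p → (projection d (fun _ : Fin 1 => p) x).rep = u • π x.rep) := by
    intro x
    by_cases hx : x = p
    · exact ⟨1, one_ne_zero, fun h => absurd hx h⟩
    · obtain ⟨u, hu, h⟩ := hπ x hx
      exact ⟨u, hu, fun _ => h⟩
  choose u hu0 hu using hu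
  refine ⟨s, u, hs, hu0, fun v hv => ?_⟩
  have h1 : (fun i => (projection d (fun _ : Fin 1 => p) (v i)).rep) =
      fun i => u (v i) • π (v i).rep := funext fun i => hu _ (hv i)
  rw [h1, dt_smul, h]
  ring

/-- The determinant of five vectors of `F^5`. -/
def det5 (a b c d e : Fin 5 → F) : F := dt ![a, b, c, d, e]

lemma exists_det3_projection_eq (p : Pt F 4) :
    ∃ (s : F) (u : Pt F 4 → F), s ≠ 0 ∧ (∀ x, u x ≠ 0) ∧ ∀ a b c, a ≠ p → b ≠ p → c ≠ p →
      det3 (projection 2 (fun _ : Fin 1 => p) a).rep (projection 2 (fun _ : Fin 1 => p) b).rep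
        (projection 2 (fun _ : Fin 1 => p) c).rep =
          s * (u a * u b * u c) * det4 p.rep a.rep b.rep c.rep := by
  obtain ⟨s, u, hs, hu, h⟩ := exists_dt_projection_eq p
  refine ⟨s, u, hs, hu, fun a b c ha hb hc => ?_⟩
  have h1 := h ![a, b, c] (by intro i; fin_cases i <;> simpa)
  have e : ∀ {m : ℕ} (f : Pt F 4 → Fin m → F), (fun i => f (![a, b, c] i)) = ![f a, f b, f c] := by
    intro m f; ext i j; fin_cases i <;> rfl
  rw [e fun x => (projection 2 (fun _ : Fin 1 => p) x).rep, e fun x => x.rep,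
    Fin.prod_univ_three] at h1
  exact h1

lemma exists_det4_projection_eq (p : Pt F 5) :
    ∃ (s : F) (u : Pt F 5 → F), s ≠ 0 ∧ (∀ x, u x ≠ 0) ∧
      ∀ a b c d, a ≠ p → b ≠ p → c ≠ p → d ≠ p →
      det4 (projection 3 (fun _ : Fin 1 => p) a).rep (projection 3 (fun _ : Fin 1 => p) b).rep
        (projection 3 (fun _ : Fin 1 => p) c).rep (projection 3 (fun _ : Fin 1 => p) d).rep =
          s * (u a * u b * u c * u d) * det5 p.rep a.rep b.rep c.rep d.rep := by
  obtain ⟨s, u, hs, hu, h⟩ := exists_dt_projection_eq p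
  refine ⟨s, u, hs, hu, fun a b c d ha hb hc hd => ?_⟩
  have h1 := h ![a, b, c, d] (by intro i; fin_cases i <;> simpa)
  have e : ∀ {m : ℕ} (f : Pt F 5 → Fin m → F),
      (fun i => f (![a, b, c, d] i)) = ![f a, f b, f c, f d] := by
    intro m f; ext i j; fin_cases i <;> rfl
  rw [e fun x => (projection 3 (fun _ : Fin 1 => p) x).rep, e fun x => x.rep,
    Fin.prod_univ_four] at h1
  exact h1

lemma exists_det4_mapPt_eq (g : (Fin 4 → F) ≃ₗ[F] (Fin 4 → F)) :
    ∃ (s : F) (u : Pt F 4 → F), s ≠ 0 ∧ (∀ x, u x ≠ 0) ∧ ∀ a b c d,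
      det4 (mapPt g a).rep (mapPt g b).rep (mapPt g c).rep (mapPt g d).rep =
          s * (u a * u b * u c * u d) * det4 a.rep b.rep c.rep d.rep := by
  have hu : ∀ x : Pt F 4, ∃ u : F, u ≠ 0 ∧ (mapPt g x).rep = u • g x.rep := by
    intro x
    have hne : g x.rep ≠ 0 := by simpa using x.rep_nonzero
    have hmk : mapPt g x = Projectivization.mk F (g x.rep) hne := by
      conv_lhs => rw [← x.mk_rep]
      rfl
    obtain ⟨a, ha⟩ := Projectivization.exists_smul_eq_mk_rep F (g x.rep) hne
    exact ⟨a, a.ne_zero, by rw [hmk, ← ha]; rfl⟩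
  choose u hu0 hu using hu
  refine ⟨LinearMap.det g.toLinearMap, u, g.isUnit_det'.ne_zero, hu0, fun a b c d => ?_⟩
  have e : ∀ f : Pt F 4 → Fin 4 → F, ![f a, f b, f c, f d] = fun i => f (![a, b, c, d] i) := by
    intro f; ext i j; fin_cases i <;> rfl
  rw [det4, e fun x => (mapPt g x).rep]
  simp only [hu]
  have h1 : (dt fun i => g (![a, b, c, d] i).rep) = _ :=
    dt_map g.toLinearMap fun i => (![a, b, c, d] i).rep
  rw [dt_smul, h1, Fin.prod_univ_four, det4, e fun x => x.rep]
  simp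
  ring

end Projections

section Duality

lemma clsB3_eq_zero {z : QF F} (h : z ∈ R3 F) : clsB3 F z = 0 :=
  (Submodule.Quotient.mk_eq_zero _).mpr h

lemma clsB3_gen_inv (a : F) : clsB3 F (gen a⁻¹) = clsB3 F (gen a) := by
  have h : clsB3 F (gen a - gen a⁻¹) = 0 :=
    clsB3_eq_zero (Submodule.subset_span (Or.inl (Or.inl ⟨a, rfl⟩)))
  rw [map_sub, sub_eq_zero] at h
  exact h.symm

lemma clsB3_sevenTerm (x : Fin 7 → Pt F 3) (hx : ∀ i j k : Fin 7, i ≠ j → i ≠ k → j ≠ k →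
    det3 (x i).rep (x j).rep (x k).rep ≠ 0) :
    altSum (fun _ z => clsB3 F (r3free z)) x = 0 := by
  have h : clsB3 F (altSum (fun _ z => r3free z) x) = 0 :=
    clsB3_eq_zero (Submodule.subset_span (Or.inl (Or.inr ⟨x, hx, rfl⟩)))
  rwa [map_altSum] at h

lemma r3free_comp {P : Type} (f : P → Pt F 3) (z : Fin 6 → P) :
    r3free (f ∘ z) = bracketR3 (fun a b c => det3 (f a).rep (f b).rep (f c).rep) z := rfl

lemma r3From4_comp {P : Type} (e : Pt F 4) (f : P → Pt F 4) (z : Fin 6 → P) :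
    r3From4 e (f ∘ z) =
      bracketR3 (fun a b c => det4 e.rep (f a).rep (f b).rep (f c).rep) z := rfl

lemma r3From4_eq (e : Pt F 4) (z : Fin 6 → Pt F 4) :
    r3From4 e z = bracketR3 (fun a b c => det4 e.rep a.rep b.rep c.rep) z := rfl

/-- The seven-term relation for the projections of seven points of `P^3` from a point. -/
lemma clsB3_sevenTerm_projected (e : Pt F 4) (x : Fin 7 → Pt F 4) (he : ∀ i, x i ≠ e)
    (hx : ∀ i j k : Fin 7, i ≠ j → i ≠ k → j ≠ k →
      det4 e.rep (x i).rep (x j).rep (x k).rep ≠ 0) :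
    altSum (fun _ z => clsB3 F (r3From4 e z)) x = 0 := by
  obtain ⟨s, u, hs, hu, h⟩ := exists_det3_projection_eq e
  have h7 := clsB3_sevenTerm (projection 2 (fun _ : Fin 1 => e) ∘ x) (fun i j k hij hik hjk => by
    simp only [Function.comp_apply]
    rw [h _ _ _ (he i) (he j) (he k)]
    simp [hs, hu, hx i j k hij hik hjk])
  rw [← h7]
  refine Finset.sum_congr rfl fun i _ => ?_
  have hr : r3From4 e (x ∘ i.succAbove) =
      r3free (projection 2 (fun _ : Fin 1 => e) ∘ x ∘ i.succAbove) := by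
    rw [r3free_comp, r3From4_eq]
    exact (bracketR3_congr s u {a | a ≠ e} hs (fun a _ => hu a) (fun j => he _)
      (fun a ha b hb c hc => h a b c ha hb hc)).symm
  simp only [Function.comp_assoc, hr]

lemma dt_comp_perm {d : ℕ} (v : Fin d → Fin d → F) (σ : Equiv.Perm (Fin d)) :
    dt (v ∘ σ) = ((Equiv.Perm.sign σ : ℤ) : F) * dt v :=
  Matrix.det_permute σ (Matrix.of v)

lemma det3_eq (a b c : Fin 3 → F) : det3 a b c =
    a 0 * b 1 * c 2 - a 0 * b 2 * c 1 - a 1 * b 0 * c 2 + a 1 * b 2 * c 0 + a 2 * b 0 * c 1 -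
      a 2 * b 1 * c 0 := by
  simp [det3, dt, Matrix.det_fin_three]

lemma det4_swap01 (a b c d : Fin 4 → F) : det4 b a c d = -det4 a b c d := by
  have h := dt_comp_perm ![a, b, c, d] (Equiv.swap 0 1)
  rw [Equiv.Perm.sign_swap (by decide)] at h
  have e : ![a, b, c, d] ∘ Equiv.swap 0 1 = ![b, a, c, d] := by
    funext k; fin_cases k <;> rfl
  rw [e] at h
  simpa [det4] using h

lemma det4_swap12 (a b c d : Fin 4 → F) : det4 a c b d = -det4 a b c d := by
  have h := dt_comp_perm ![a, b, c, d] (Equiv.swap 1 2)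
  rw [Equiv.Perm.sign_swap (by decide)] at h
  have e : ![a, b, c, d] ∘ Equiv.swap 1 2 = ![a, c, b, d] := by
    funext k; fin_cases k <;> rfl
  rw [e] at h
  simpa [det4] using h

lemma det4_swap23 (a b c d : Fin 4 → F) : det4 a b d c = -det4 a b c d := by
  have h := dt_comp_perm ![a, b, c, d] (Equiv.swap 2 3)
  rw [Equiv.Perm.sign_swap (by decide)] at h
  have e : ![a, b, c, d] ∘ Equiv.swap 2 3 = ![a, b, d, c] := by
    funext k; fin_cases k <;> rfl
  rw [e] at h
  simpa [det4] using h

lemma det4_self01 (a c d : Fin 4 → F) : det4 a a c d = 0 :=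
  Matrix.det_zero_of_row_eq (i := 0) (j := 1) (by decide) rfl

/-- The left-hand vector of a determinant of four vectors, as a linear form. -/
def det4Left (p q r : Fin 4 → F) : (Fin 4 → F) →ₗ[F] F where
  toFun a := det4 a p q r
  map_add' a b := by
    simp [det4, dt, Matrix.det_succ_row_zero, Fin.sum_univ_succ]; ring
  map_smul' c a := by
    simp [det4, dt, Matrix.det_succ_row_zero, Fin.sum_univ_succ]; ring

/-- The configurations `w` in `F^3` and `x` in `F^4` are (Gale) dual: the rows of `w` are linear
relations between the vectors of `x`. -/
def GaleDual (w : Fin 7 → Fin 3 → F) (x : Fin 7 → Fin 4 → F) : Prop :=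
  ∀ j : Fin 3, ∑ i, w i j • x i = 0

lemma GaleDual.comp_perm {w : Fin 7 → Fin 3 → F} {x : Fin 7 → Fin 4 → F} (h : GaleDual w x)
    (σ : Equiv.Perm (Fin 7)) : GaleDual (w ∘ σ) (x ∘ σ) := by
  intro j
  rw [← h j]
  exact Equiv.sum_comp σ fun i => w i j • x i

lemma GaleDual.exchange {w : Fin 7 → Fin 3 → F} {x : Fin 7 → Fin 4 → F} (h : GaleDual w x) :
    det3 (w 0) (w 1) (w 3) * det4 (x 3) (x 4) (x 5) (x 6) =
      -(det3 (w 0) (w 1) (w 2) * det4 (x 2) (x 4) (x 5) (x 6)) := by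
  have h1 : ∀ j : Fin 3, ∑ i, w i j * det4 (x i) (x 4) (x 5) (x 6) = 0 := by
    intro j
    have := congrArg (det4Left (x 4) (x 5) (x 6)) (h j)
    rw [map_sum, map_zero] at this
    simpa [det4Left] using this
  have h4 : det4 (x 4) (x 4) (x 5) (x 6) = 0 := det4_self01 _ _ _
  have h5 : det4 (x 5) (x 4) (x 5) (x 6) = 0 := by
    rw [← neg_eq_zero, ← det4_swap12, det4_self01]
  have h6 : det4 (x 6) (x 4) (x 5) (x 6) = 0 := by
    rw [← neg_eq_zero, ← det4_swap23, ← neg_eq_zero, ← det4_swap12, det4_self01]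
  simp only [Fin.sum_univ_seven, h4, h5, h6] at h1
  have a0 := h1 0
  have a1 := h1 1
  have a2 := h1 2
  simp only [det3_eq]
  linear_combination (w 0 1 * w 1 2 - w 0 2 * w 1 1) * a0 + (w 0 2 * w 1 0 - w 0 0 * w 1 2) * a1 +
    (w 0 0 * w 1 1 - w 0 1 * w 1 0) * a2

/-- Complementary minors of dual configurations are proportional. -/
lemma GaleDual.minor_eq {w : Fin 7 → Fin 3 → F} {x : Fin 7 → Fin 4 → F} (h : GaleDual w x)
    (hx : ∀ i j k l : Fin 7, i ≠ j → i ≠ k → i ≠ l → j ≠ k → j ≠ l → k ≠ l →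
      det4 (x i) (x j) (x k) (x l) ≠ 0) (σ : Equiv.Perm (Fin 7)) :
    det3 (w (σ 0)) (w (σ 1)) (w (σ 2)) = ((Equiv.Perm.sign σ : ℤ) : F) *
      (det3 (w 0) (w 1) (w 2) / det4 (x 3) (x 4) (x 5) (x 6)) *
        det4 (x (σ 3)) (x (σ 4)) (x (σ 5)) (x (σ 6)) := by
  have hσ : σ ∈ Submonoid.closure
      (Set.range fun i : Fin 6 => Equiv.swap i.castSucc i.succ) := by
    rw [Equiv.Perm.mclosure_swap_castSucc_succ]; trivial
  induction hσ using Submonoid.closure_induction_right with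
  | one =>
    have := hx 3 4 5 6 (by decide) (by decide) (by decide) (by decide) (by decide) (by decide)
    simp [this]
  | mul_right a ha b hb ih =>
    obtain ⟨i, rfl⟩ := hb
    set c := det3 (w 0) (w 1) (w 2) / det4 (x 3) (x 4) (x 5) (x 6)
    rw [Equiv.Perm.sign_mul, Equiv.Perm.sign_swap (by simp [Fin.ext_iff])]
    have hex := (h.comp_perm a).exchange
    simp only [Function.comp_apply] at hex
    have hne : det4 (x (a 3)) (x (a 4)) (x (a 5)) (x (a 6)) ≠ 0 := by
      apply hx <;> exact a.injective.ne (by decide)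
    fin_cases i
    · simp [Equiv.swap_apply_def, Fin.ext_iff]
      rw [← ih]; simp only [det3_eq]; ring
    · simp [Equiv.swap_apply_def, Fin.ext_iff]
      rw [← ih]; simp only [det3_eq]; ring
    · simp [Equiv.swap_apply_def, Fin.ext_iff]
      rw [ih] at hex
      refine mul_right_cancel₀ hne ?_
      rw [hex]; ring
    · simp [Equiv.swap_apply_def, Fin.ext_iff]
      rw [ih, det4_swap01]; ring
    · simp [Equiv.swap_apply_def, Fin.ext_iff]
      rw [ih, det4_swap12]; ring
    · simp [Equiv.swap_apply_def, Fin.ext_iff]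
      rw [ih, det4_swap23]; ring

/-- Seven generic vectors in `F^4` have a dual configuration in `F^3`. -/
lemma exists_galeDual (x : Fin 7 → Fin 4 → F) (hx : det4 (x 3) (x 4) (x 5) (x 6) ≠ 0) :
    ∃ w : Fin 7 → Fin 3 → F, GaleDual w x ∧ det3 (w 0) (w 1) (w 2) = 1 := by
  let N : Matrix (Fin 4) (Fin 4) F := Matrix.of ![x 3, x 4, x 5, x 6]
  have hN : IsUnit N.det := isUnit_iff_ne_zero.mpr hx
  have hA : ∀ j : Fin 7, ∃ a : Fin 4 → F,
      x j = a 0 • x 3 + a 1 • x 4 + a 2 • x 5 + a 3 • x 6 := by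
    intro j
    refine ⟨Matrix.vecMul (x j) N⁻¹, ?_⟩
    have h : Matrix.vecMul (Matrix.vecMul (x j) N⁻¹) N = x j := by
      rw [Matrix.vecMul_vecMul, Matrix.nonsing_inv_mul _ hN, Matrix.vecMul_one]
    conv_lhs => rw [← h]
    rw [Matrix.vecMul_eq_sum, Fin.sum_univ_four]
    rfl
  choose a ha using hA
  refine ⟨![![1, 0, 0], ![0, 1, 0], ![0, 0, 1], fun j => -a (j.castLE (by omega)) 0,
    fun j => -a (j.castLE (by omega)) 1, fun j => -a (j.castLE (by omega)) 2,
    fun j => -a (j.castLE (by omega)) 3], ?_, ?_⟩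
  · intro j
    rw [Fin.sum_univ_seven]
    fin_cases j
    · have h := ha 0
      simp
      linear_combination h
    · have h := ha 1
      simp
      linear_combination h
    · have h := ha 2
      simp
      linear_combination h
  · simp [det3_eq]

lemma GaleDual.tripleRatio_eq {w : Fin 7 → Fin 3 → F} {x : Fin 7 → Fin 4 → F} (h : GaleDual w x)
    (hx : ∀ i j k l : Fin 7, i ≠ j → i ≠ k → i ≠ l → j ≠ k → j ≠ l → k ≠ l →
      det4 (x i) (x j) (x k) (x l) ≠ 0) (hw : det3 (w 0) (w 1) (w 2) ≠ 0) :
    bracketTripleRatio (fun a b c => det4 (x 0) (x a) (x b) (x c)) ![1, 2, 3, 4, 5, 6] =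
      (bracketTripleRatio (fun a b c => det3 (w a) (w b) (w c)) ![4, 5, 6, 1, 2, 3])⁻¹ := by
  have hm := h.minor_eq hx
  have hc : det3 (w 0) (w 1) (w 2) / det4 (x 3) (x 4) (x 5) (x 6) ≠ 0 :=
    div_ne_zero hw (hx 3 4 5 6 (by decide) (by decide) (by decide) (by decide) (by decide)
      (by decide))
  set c := det3 (w 0) (w 1) (w 2) / det4 (x 3) (x 4) (x 5) (x 6)
  have key : ∀ (s t : Fin 7 → Fin 7) (h1 : Function.LeftInverse t s)
      (h2 : Function.RightInverse t s), Equiv.Perm.sign (⟨s, t, h1, h2⟩ : Equiv.Perm (Fin 7)) = -1 →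
      det3 (w (s 0)) (w (s 1)) (w (s 2)) =
        -c * det4 (x (s 3)) (x (s 4)) (x (s 5)) (x (s 6)) := by
    intro s t h1 h2 hs
    have := hm ⟨s, t, h1, h2⟩
    rw [hs] at this
    simpa using this
  have k1 := key ![5, 6, 3, 0, 1, 2, 4] ![3, 4, 5, 2, 6, 0, 1] (by decide) (by decide)
    (by decide +kernel)
  have k2 := key ![6, 4, 1, 0, 2, 3, 5] ![3, 2, 4, 5, 1, 6, 0] (by decide) (by decide)
    (by decide +kernel)
  have k3 := key ![4, 5, 2, 0, 3, 1, 6] ![3, 5, 2, 4, 0, 1, 6] (by decide) (by decide)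
    (by decide +kernel)
  have k4 := key ![6, 4, 3, 0, 1, 2, 5] ![3, 4, 5, 2, 1, 6, 0] (by decide) (by decide)
    (by decide +kernel)
  have k5 := key ![4, 5, 1, 0, 2, 3, 6] ![3, 2, 4, 5, 0, 1, 6] (by decide) (by decide)
    (by decide +kernel)
  have k6 := key ![5, 6, 2, 0, 3, 1, 4] ![3, 5, 2, 4, 6, 0, 1] (by decide) (by decide)
    (by decide +kernel)
  simp at k1 k2 k3 k4 k5 k6
  simp [bracketTripleRatio, k1, k2, k3, k4, k5, k6]
  have hc3 : c ^ 3 ≠ 0 := pow_ne_zero 3 hc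
  rw [← mul_div_mul_left _ (det4 (x 0) (x 1) (x 2) (x 5) * _ * _) hc3]
  congr 1 <;> ring

lemma GaleDual.minor_ne_zero {w : Fin 7 → Fin 3 → F} {x : Fin 7 → Fin 4 → F} (h : GaleDual w x)
    (hx : ∀ i j k l : Fin 7, i ≠ j → i ≠ k → i ≠ l → j ≠ k → j ≠ l → k ≠ l →
      det4 (x i) (x j) (x k) (x l) ≠ 0) (hw : det3 (w 0) (w 1) (w 2) ≠ 0)
    (i j k : Fin 7) (hij : i ≠ j) (hik : i ≠ k) (hjk : j ≠ k) :
    det3 (w i) (w j) (w k) ≠ 0 := by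
  obtain ⟨σ, rfl, rfl, rfl⟩ : ∃ σ : Equiv.Perm (Fin 7), σ 0 = i ∧ σ 1 = j ∧ σ 2 = k := by
    have hf : Function.Injective ![i, j, k] := by
      intro a b hab
      fin_cases a <;> fin_cases b <;> simp_all
    obtain ⟨σ, hσ⟩ := Equiv.Perm.exists_extending_pair ![(0 : Fin 7), 1, 2] ![i, j, k] (by decide) hf
    exact ⟨σ, hσ 0, hσ 1, hσ 2⟩
  rw [h.minor_eq hx]
  refine mul_ne_zero (mul_ne_zero ?_ (div_ne_zero hw ?_)) ?_
  · rcases Int.units_eq_one_or (Equiv.Perm.sign σ) with h | h <;> simp [h]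
  · exact hx 3 4 5 6 (by decide) (by decide) (by decide) (by decide) (by decide) (by decide)
  · apply hx <;> exact σ.injective.ne (by decide)

/-- Projecting from a point is dual to omitting it: the class of `r_3` changes sign. -/
lemma GaleDual.clsB3_bracketR3 {w : Fin 7 → Fin 3 → F} {x : Fin 7 → Fin 4 → F} (h : GaleDual w x)
    (hx : ∀ i j k l : Fin 7, i ≠ j → i ≠ k → i ≠ l → j ≠ k → j ≠ l → k ≠ l →
      det4 (x i) (x j) (x k) (x l) ≠ 0) (hw : det3 (w 0) (w 1) (w 2) ≠ 0) (k : Fin 7) :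
    clsB3 F (bracketR3 (fun a b c => det4 (x k) (x a) (x b) (x c)) k.succAbove) =
      -clsB3 F (bracketR3 (fun a b c => det3 (w a) (w b) (w c)) k.succAbove) := by
  let ρ : Equiv.Perm (Fin 6) := ⟨![3, 4, 5, 0, 1, 2], ![3, 4, 5, 0, 1, 2], by decide, by decide⟩
  have hρ : Equiv.Perm.sign ρ = -1 := by decide +kernel
  have ht : ∀ σ : Equiv.Perm (Fin 6),
      clsB3 F (gen (bracketTripleRatio (fun a b c => det4 (x k) (x a) (x b) (x c))
        (k.succAbove ∘ σ))) =
      clsB3 F (gen (bracketTripleRatio (fun a b c => det3 (w a) (w b) (w c))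
        (k.succAbove ∘ ⇑(σ * ρ)))) := by
    intro σ
    have hinj : Function.Injective (Fin.cons k (k.succAbove ∘ σ) : Fin 7 → Fin 7) := by
      rw [Fin.cons_injective_iff]
      refine ⟨?_, Fin.succAbove_right_injective.comp σ.injective⟩
      rintro ⟨i, hi⟩
      exact Fin.succAbove_ne _ _ hi
    let π : Equiv.Perm (Fin 7) := Equiv.ofBijective _ (Finite.injective_iff_bijective.mp hinj)
    have hr := (h.comp_perm π).tripleRatio_eq
      (fun i j k l h1 h2 h3 h4 h5 h6 => hx _ _ _ _ (π.injective.ne h1) (π.injective.ne h2)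
        (π.injective.ne h3) (π.injective.ne h4) (π.injective.ne h5) (π.injective.ne h6))
      (h.minor_ne_zero hx hw _ _ _ (π.injective.ne (by decide)) (π.injective.ne (by decide))
        (π.injective.ne (by decide)))
    have hl : bracketTripleRatio (fun a b c => det4 (x k) (x a) (x b) (x c)) (k.succAbove ∘ σ) =
        (bracketTripleRatio (fun a b c => det3 (w a) (w b) (w c)) (k.succAbove ∘ ⇑(σ * ρ)))⁻¹ := hr
    rw [hl, clsB3_gen_inv]
  unfold bracketR3
  simp only [map_smul, map_sum, map_zsmul, ht]
  rw [← smul_neg, ← Finset.sum_neg_distrib]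
  refine congrArg _ (Fintype.sum_equiv (Equiv.mulRight ρ) _ _ fun σ => ?_)
  simp [hρ]

/-- The dual seven-term relation for seven points of `P^3`. -/
lemma clsB3_dualSevenTerm (x : Fin 7 → Pt F 4)
    (hx : ∀ i j k l : Fin 7, i ≠ j → i ≠ k → i ≠ l → j ≠ k → j ≠ l → k ≠ l →
      det4 (x i).rep (x j).rep (x k).rep (x l).rep ≠ 0) :
    altSum (fun p z => clsB3 F (r3From4 p z)) x = 0 := by
  obtain ⟨w, hd, hw⟩ := exists_galeDual (fun i => (x i).rep) (hx 3 4 5 6 (by decide) (by decide)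
    (by decide) (by decide) (by decide) (by decide))
  have hw' : det3 (w 0) (w 1) (w 2) ≠ 0 := by rw [hw]; exact one_ne_zero
  have hm := hd.minor_ne_zero hx hw'
  have hthree : ∀ i : Fin 7, ∃ j k : Fin 7, i ≠ j ∧ i ≠ k ∧ j ≠ k := by decide
  have hw0 : ∀ i, w i ≠ 0 := by
    intro i hi
    obtain ⟨j, k, h1, h2, h3⟩ := hthree i
    apply hm i j k h1 h2 h3
    rw [hi, det3_eq]; simp
  choose u hu using fun i => Projectivization.exists_smul_eq_mk_rep F (w i) (hw0 i)
  have hu' : ∀ i, (Projectivization.mk F (w i) (hw0 i)).rep = (u i : F) • w i :=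
    fun i => (hu i).symm
  have hs : ∀ i j k : Fin 7, det3 (Projectivization.mk F (w i) (hw0 i)).rep
      (Projectivization.mk F (w j) (hw0 j)).rep (Projectivization.mk F (w k) (hw0 k)).rep =
        1 * ((u i : F) * u j * u k) * det3 (w i) (w j) (w k) := by
    intro i j k
    rw [hu', hu', hu', det3_eq, det3_eq]
    simp only [Pi.smul_apply, smul_eq_mul]
    ring
  have h7 := clsB3_sevenTerm (fun i => Projectivization.mk F (w i) (hw0 i))
    (fun i j k hij hik hjk => by rw [hs]; simp [hm i j k hij hik hjk])
  rw [← neg_eq_zero, ← altSum_neg, ← h7]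
  refine Finset.sum_congr rfl fun k _ => ?_
  have h1 := hd.clsB3_bracketR3 hx hw' k
  have h2 : r3free ((fun i => Projectivization.mk F (w i) (hw0 i)) ∘ k.succAbove) =
      bracketR3 (fun a b c => det3 (w a) (w b) (w c)) k.succAbove := by
    rw [r3free_comp]
    exact bracketR3_congr 1 (fun i => (u i : F)) Set.univ one_ne_zero (fun i _ => (u i).ne_zero)
      (fun _ => trivial) (fun a _ b _ c _ => hs a b c)
  simp only [h2, r3From4_comp, h1, neg_neg]

end Duality

section GenericPairs

variable {l m : Fin 4 → Pt F 4}

lemma GenericPair.injective (h : GenericPair l m) : Function.Injective (Fin.append l m) := by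
  have hex : ∀ a b : Fin 8, a ≠ b → ∃ c d : Fin 8, a ≠ c ∧ a ≠ d ∧ b ≠ c ∧ b ≠ d ∧ c ≠ d := by
    decide
  intro a b hab
  by_contra hne
  obtain ⟨c, d, h1, h2, h3, h4, h5⟩ := hex a b hne
  apply h a b c d hne h1 h2 h3 h4 h5
  rw [hab, det4_self01]

lemma GenericPair.left_injective (h : GenericPair l m) : Function.Injective l := by
  intro a b hab
  have h1 : Fin.append l m (Fin.castAdd 4 a) = Fin.append l m (Fin.castAdd 4 b) := by
    rwa [Fin.append_left, Fin.append_left]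
  exact Fin.castAdd_injective 4 4 (h.injective h1)

lemma GenericPair.left_ne_right (h : GenericPair l m) (i j : Fin 4) : l i ≠ m j := by
  intro hij
  have h1 : Fin.append l m (Fin.castAdd 4 i) = Fin.append l m (Fin.natAdd 4 j) := by
    rwa [Fin.append_left, Fin.append_right]
  have h2 := congrArg Fin.val (h.injective h1)
  rw [Fin.val_castAdd, Fin.val_natAdd] at h2
  omega

/-- Genericity does not depend on the order of the vertices of the first tetrahedron. -/
lemma GenericPair.perm_left (h : GenericPair l m) (σ : Equiv.Perm (Fin 4)) :
    GenericPair (l ∘ σ) m := by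
  let e : Fin (4 + 4) ≃ Fin (4 + 4) :=
    finSumFinEquiv.symm.trans ((Equiv.sumCongr σ (Equiv.refl (Fin 4))).trans finSumFinEquiv)
  have he : ∀ a : Fin (4 + 4), Fin.append (l ∘ σ) m a = Fin.append l m (e a) := by
    intro a
    obtain ⟨t, rfl⟩ := (finSumFinEquiv (m := 4) (n := 4)).surjective a
    rcases t with i | i
    · simp only [e, Equiv.trans_apply, Equiv.sumCongr_apply, finSumFinEquiv_apply_left,
        finSumFinEquiv_symm_apply_castAdd, Sum.map_inl, Fin.append_left, Function.comp_apply]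
    · simp only [e, Equiv.trans_apply, Equiv.sumCongr_apply, finSumFinEquiv_apply_right,
        finSumFinEquiv_symm_apply_natAdd, Sum.map_inr, Fin.append_right, Equiv.refl_apply]
  intro a b c d h1 h2 h3 h4 h5 h6
  rw [he a, he b, he c, he d]
  exact h _ _ _ _ (e.injective.ne h1) (e.injective.ne h2) (e.injective.ne h3) (e.injective.ne h4)
    (e.injective.ne h5) (e.injective.ne h6)

lemma GenericPair.symm (h : GenericPair l m) : GenericPair m l := by
  let s : Fin 8 → Fin 8 := ![4, 5, 6, 7, 0, 1, 2, 3]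
  have hs : ∀ a b, a ≠ b → s a ≠ s b := by decide
  have hml : ∀ a, Fin.append m l a = Fin.append l m (s a) := by
    intro a; fin_cases a <;> rfl
  intro a b c d h1 h2 h3 h4 h5 h6
  simp only [hml]
  exact h _ _ _ _ (hs _ _ h1) (hs _ _ h2) (hs _ _ h3) (hs _ _ h4) (hs _ _ h5) (hs _ _ h6)

/-- Seven of the eight vertices of a pair of tetrahedra, `i` being the omitted vertex of the
first one. -/
lemma GenericPair.exists_seven (l m : Fin 4 → Pt F 4) (i : Fin 4) :
    ∃ s : Fin 7 → Fin 8, Function.Injective s ∧ (∀ j, s j ≠ Fin.castAdd 4 i) ∧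
      Fin.append l m (Fin.castAdd 4 i) = l i ∧
      ![l (i.succAbove 0), l (i.succAbove 1), l (i.succAbove 2), m 0, m 1, m 2, m 3] =
        Fin.append l m ∘ s := by
  refine ⟨![Fin.castAdd 4 (i.succAbove 0), Fin.castAdd 4 (i.succAbove 1),
    Fin.castAdd 4 (i.succAbove 2), 4, 5, 6, 7], ?_, ?_, Fin.append_left _ _ _, ?_⟩
  · revert i; decide
  · revert i; decide
  · have h4 : ∀ j : Fin 4, m j = Fin.append l m (Fin.natAdd 4 j) :=
      fun j => (Fin.append_right l m j).symm
    funext k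
    fin_cases k <;> first | exact (Fin.append_left l m _).symm | exact h4 _

end GenericPairs

section Tetrahedra

variable {P : Type}

/-- Six points made of two triples. -/
def joinTriples (x y : Fin 3 → P) : Fin 6 → P := ![x 0, x 1, x 2, y 0, y 1, y 2]

lemma joinTriples_swap01 (x y : Fin 3 → P) :
    joinTriples (x ∘ Equiv.swap 0 1) y = joinTriples x y ∘ Equiv.swap 0 1 := by
  funext k; fin_cases k <;> rfl

lemma joinTriples_swap12 (x y : Fin 3 → P) :
    joinTriples (x ∘ Equiv.swap 1 2) y = joinTriples x y ∘ Equiv.swap 1 2 := by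
  funext k; fin_cases k <;> rfl

lemma bracketR3_joinTriples_comm (ψ : P → P → P → F) (x y : Fin 3 → P) :
    bracketR3 ψ (joinTriples y x) = -bracketR3 ψ (joinTriples x y) := by
  let ρ : Equiv.Perm (Fin 6) := ⟨![3, 4, 5, 0, 1, 2], ![3, 4, 5, 0, 1, 2], by decide, by decide⟩
  have hρ : Equiv.Perm.sign ρ = -1 := by decide +kernel
  have h : joinTriples y x = joinTriples x y ∘ ρ := by
    funext k; fin_cases k <;> rfl
  rw [h, bracketR3_perm, hρ]
  simp

/-- `a_3'` for the images of two quadruples under a map to `P^3`. -/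
lemma a3p_comp (g : P → Pt F 4) (l m : Fin 4 → P) :
    a3p (g ∘ l) (g ∘ m) = altSum (fun p x => altSum (fun _ y =>
      bracketR3 (fun a b c => det4 (g p).rep (g a).rep (g b).rep (g c).rep)
        (joinTriples x y)) m) l := by
  have h : ∀ a b c d e f : P, ![g a, g b, g c, g d, g e, g f] = g ∘ ![a, b, c, d, e, f] := by
    intro a b c d e f; funext k; fin_cases k <;> rfl
  simp only [a3p, altSum, Finset.smul_sum, smul_smul, pow_add, Function.comp_apply, h,
    r3From4_comp, joinTriples]

/-- `a_3''` for the images of two quadruples under a map to `P^3`. -/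
lemma a3pp_comp (g : P → Pt F 4) (l m : Fin 4 → P) :
    a3pp (g ∘ l) (g ∘ m) = altSum (fun p x => altSum (fun q y =>
      mu3 (bracketCr fun a b => det4 (g p).rep (g q).rep (g a).rep (g b).rep) x y) m) l := by
  simp only [a3pp, altSum, Finset.smul_sum, smul_smul, pow_add]
  rfl

lemma a3p_eq (l m : Fin 4 → Pt F 4) :
    a3p l m = altSum (fun p x => altSum (fun _ y => r3From4 p (joinTriples x y)) m) l :=
  a3p_comp id l m

lemma a3pp_eq (l m : Fin 4 → Pt F 4) :
    a3pp l m = altSum (fun p x => altSum (fun q y => mu3 (crLine p q) x y) m) l :=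
  a3pp_comp id l m

lemma crLine_eq (p q : Pt F 4) :
    crLine p q = bracketCr fun a b => det4 p.rep q.rep a.rep b.rep := rfl

lemma clsB3_a3p (l m : Fin 4 → Pt F 4) :
    clsB3 F (a3p l m) =
      altSum (fun p x => altSum (fun _ y => clsB3 F (r3From4 p (joinTriples x y))) m) l := by
  simp only [a3p_eq, map_altSum]

lemma a3p_perm_left (l m : Fin 4 → Pt F 4) (σ : Equiv.Perm (Fin 4)) :
    a3p (l ∘ σ) m = (Equiv.Perm.sign σ : ℤ) • a3p l m := by
  rw [a3p_eq, a3p_eq]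
  refine altSum_perm _ (fun p x => ?_) (fun p x => ?_) l σ
  · simp only [joinTriples_swap01, r3From4_eq, bracketR3_perm]
    rw [Equiv.Perm.sign_swap (by decide), ← altSum_neg]
    simp
  · simp only [joinTriples_swap12, r3From4_eq, bracketR3_perm]
    rw [Equiv.Perm.sign_swap (by decide), ← altSum_neg]
    simp

lemma a3pp_perm_left (l m : Fin 4 → Pt F 4) (σ : Equiv.Perm (Fin 4)) :
    a3pp (l ∘ σ) m = (Equiv.Perm.sign σ : ℤ) • a3pp l m := by
  rw [a3pp_eq, a3pp_eq]
  refine altSum_perm _ (fun p x => ?_) (fun p x => ?_) l σ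
  · simp only [mu3_perm_left]
    rw [Equiv.Perm.sign_swap (by decide), ← altSum_neg]
    simp
  · simp only [mu3_perm_left]
    rw [Equiv.Perm.sign_swap (by decide), ← altSum_neg]
    simp

/-- By the seven-term relation, the sum over the vertices of the second tetrahedron can be traded
for a sum over the vertices of the first one. -/
lemma GenericPair.sevenTerm {l m : Fin 4 → Pt F 4} (h : GenericPair l m) (i : Fin 4) :
    altSum (fun _ y => clsB3 F (r3From4 (l i) (joinTriples (l ∘ i.succAbove) y))) m =
      altSum (fun _ (z : Fin 2 → Pt F 4) =>
        clsB3 F (r3From4 (l i) ![z 0, z 1, m 0, m 1, m 2, m 3])) (l ∘ i.succAbove) := by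
  obtain ⟨s, hs, hsi, hi, hv⟩ := exists_seven l m i
  have h7 := clsB3_sevenTerm_projected (l i) (Fin.append l m ∘ s)
    (fun j => by rw [← hi]; exact h.injective.ne (hsi j))
    (fun a b c hab hac hbc => by
      rw [← hi]
      exact h _ _ _ _ (hsi a).symm (hsi b).symm (hsi c).symm (hs.ne hab) (hs.ne hac) (hs.ne hbc))
  rw [← hv] at h7
  have h34 := altSum_three_four (fun _ z => clsB3 F (r3From4 (l i) z)) (l ∘ i.succAbove) m
  exact (sub_eq_zero.mp (h34.symm.trans h7)).symm

lemma GenericPair.dualSevenTerm {l m : Fin 4 → Pt F 4} (h : GenericPair l m) (i : Fin 4) :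
    altSum (fun q y => clsB3 F (r3From4 q (joinTriples (l ∘ i.succAbove) y))) m =
      altSum (fun q (z : Fin 2 → Pt F 4) =>
        clsB3 F (r3From4 q ![z 0, z 1, m 0, m 1, m 2, m 3])) (l ∘ i.succAbove) := by
  obtain ⟨s, hs, hsi, hi, hv⟩ := exists_seven l m i
  have h7 := clsB3_dualSevenTerm (Fin.append l m ∘ s)
    (fun a b c d h1 h2 h3 h4 h5 h6 => h _ _ _ _ (hs.ne h1) (hs.ne h2) (hs.ne h3) (hs.ne h4)
      (hs.ne h5) (hs.ne h6))
  rw [← hv] at h7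
  have h34 := altSum_three_four (fun q z => clsB3 F (r3From4 q z)) (l ∘ i.succAbove) m
  exact (sub_eq_zero.mp (h34.symm.trans h7)).symm

lemma GenericPair.clsB3_a3p_eq {l m : Fin 4 → Pt F 4} (h : GenericPair l m) :
    clsB3 F (a3p l m) = altSum (fun p x => altSum (fun _ (z : Fin 2 → Pt F 4) =>
      clsB3 F (r3From4 p ![z 0, z 1, m 0, m 1, m 2, m 3])) x) l := by
  rw [clsB3_a3p]
  exact altSum_congr h.sevenTerm

lemma clsB3_a3p_comm {l m : Fin 4 → Pt F 4} (h : GenericPair l m) :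
    clsB3 F (a3p l m) = clsB3 F (a3p m l) := by
  rw [h.clsB3_a3p_eq, altSum_altSum_swap, clsB3_a3p, altSum_comm, ← altSum_neg]
  refine altSum_congr fun i => ?_
  rw [← h.dualSevenTerm, ← altSum_neg]
  refine altSum_congr fun j => ?_
  rw [r3From4_eq, r3From4_eq, bracketR3_joinTriples_comm, map_neg, neg_neg]

lemma a3pp_comm (l m : Fin 4 → Pt F 4) : a3pp l m = a3pp m l := by
  rw [a3pp_eq, a3pp_eq, altSum_comm]
  refine altSum_congr fun i => altSum_congr fun j => ?_
  rw [crLine_eq, crLine_eq, mu3_bracketCr_comm (fun a b => det4_swap23 _ _ _ _)]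
  exact mu3_bracketCr_congr (-1) (fun _ => 1) Set.univ (by simp) (by simp)
    (fun a _ b _ => by rw [det4_swap01]; ring) (fun _ => trivial) (fun _ => trivial)

lemma altSum_clsB3_a3p_eq_zero {l : Fin 5 → Pt F 4} {m : Fin 4 → Pt F 4}
    (h : ∀ i : Fin 5, GenericPair (l ∘ i.succAbove) m) :
    altSum (fun _ x => clsB3 F (a3p x m)) l = 0 := by
  rw [altSum_congr (H := fun _ w => altSum (fun p x => altSum (fun _ (z : Fin 2 → Pt F 4) =>
      clsB3 F (r3From4 p ![z 0, z 1, m 0, m 1, m 2, m 3])) x) w) fun i => (h i).clsB3_a3p_eq,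
    altSum_altSum_swap, neg_eq_zero, ← altSum_zero (M := B3 F) l]
  exact altSum_congr fun i => altSum_altSum_eq_zero rfl

lemma altSum_a3pp_eq_zero (l : Fin 5 → Pt F 4) (m : Fin 4 → Pt F 4) :
    altSum (fun _ x => a3pp x m) l = 0 := by
  simp only [a3pp_eq]
  rw [altSum_altSum_swap, neg_eq_zero, ← altSum_zero (M := QF F) l]
  refine altSum_congr fun i => ?_
  rw [altSum_comm, ← altSum_zero (M := QF F) m]
  exact altSum_congr fun j => mu3_altSum_eq_zero _ _ _

lemma a3p_mapPt (g : (Fin 4 → F) ≃ₗ[F] (Fin 4 → F)) (l m : Fin 4 → Pt F 4) :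
    a3p (mapPt g ∘ l) (mapPt g ∘ m) = a3p l m := by
  obtain ⟨s, u, hs, hu, h⟩ := exists_det4_mapPt_eq g
  rw [a3p_comp, a3p_eq]
  refine altSum_congr fun i => altSum_congr fun j => ?_
  rw [r3From4_eq]
  exact bracketR3_congr (s * u (l i)) u Set.univ (mul_ne_zero hs (hu _)) (fun a _ => hu a)
    (fun _ => trivial) (fun a _ b _ c _ => by rw [h]; ring)

lemma a3pp_mapPt (g : (Fin 4 → F) ≃ₗ[F] (Fin 4 → F)) (l m : Fin 4 → Pt F 4) :
    a3pp (mapPt g ∘ l) (mapPt g ∘ m) = a3pp l m := by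
  obtain ⟨s, u, hs, hu, h⟩ := exists_det4_mapPt_eq g
  rw [a3pp_comp, a3pp_eq]
  refine altSum_congr fun i => altSum_congr fun j => ?_
  rw [crLine_eq]
  exact mu3_bracketCr_congr (s * u (l i) * u (m j)) u Set.univ
    (mul_ne_zero (mul_ne_zero hs (hu _)) (hu _)) (fun a _ => hu a)
    (fun a _ b _ => by rw [h]; ring) (fun _ => trivial) (fun _ => trivial)

end Tetrahedra

section DualAdditivity

lemma det5_swap01 (a b c d e : Fin 5 → F) : det5 b a c d e = -det5 a b c d e := by
  have h := dt_comp_perm ![a, b, c, d, e] (Equiv.swap 0 1)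
  rw [Equiv.Perm.sign_swap (by decide)] at h
  have h' : ![a, b, c, d, e] ∘ Equiv.swap 0 1 = ![b, a, c, d, e] := by
    funext k; fin_cases k <;> rfl
  rw [h'] at h
  simpa [det5] using h

variable {l : Fin 5 → Pt F 5} {m : Fin 4 → Pt F 5}

lemma left_injective_of_projection (h : ∀ i : Fin 5, GenericPair
      (projection 3 (fun _ : Fin 1 => l i) ∘ (l ∘ i.succAbove))
      (projection 3 (fun _ : Fin 1 => l i) ∘ m)) : Function.Injective l := by
  have hex : ∀ a b : Fin 5, ∃ i : Fin 5, a ≠ i ∧ b ≠ i := by decide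
  intro a b hab
  obtain ⟨i, hai, hbi⟩ := hex a b
  obtain ⟨a, rfl⟩ := Fin.exists_succAbove_eq hai
  obtain ⟨b, rfl⟩ := Fin.exists_succAbove_eq hbi
  have hab' := congrArg (projection 3 (fun _ : Fin 1 => l i)) hab
  exact congrArg _ ((h i).left_injective hab')

lemma left_ne_right_of_projection (h : ∀ i : Fin 5, GenericPair
      (projection 3 (fun _ : Fin 1 => l i) ∘ (l ∘ i.succAbove))
      (projection 3 (fun _ : Fin 1 => l i) ∘ m)) (a : Fin 5) (j : Fin 4) : m j ≠ l a := by
  have hex : ∀ a : Fin 5, ∃ i : Fin 5, a ≠ i := by decide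
  intro haj
  obtain ⟨i, hai⟩ := hex a
  obtain ⟨a, rfl⟩ := Fin.exists_succAbove_eq hai
  exact (h i).left_ne_right a j (congrArg (projection 3 (fun _ : Fin 1 => l i)) haj.symm)

lemma sum_a3p_projection_eq_zero (h : ∀ i : Fin 5, GenericPair
      (projection 3 (fun _ : Fin 1 => l i) ∘ (l ∘ i.succAbove))
      (projection 3 (fun _ : Fin 1 => l i) ∘ m)) :
    altSum (fun e w => a3p (projection 3 (fun _ : Fin 1 => e) ∘ w)
      (projection 3 (fun _ : Fin 1 => e) ∘ m)) l = 0 := by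
  have hl := left_injective_of_projection h
  have hm := left_ne_right_of_projection h
  have hp : ∀ i : Fin 5, a3p (projection 3 (fun _ : Fin 1 => l i) ∘ (l ∘ i.succAbove))
      (projection 3 (fun _ : Fin 1 => l i) ∘ m) = altSum (fun p x => altSum (fun _ y =>
        bracketR3 (fun a b c => det5 (l i).rep p.rep a.rep b.rep c.rep) (joinTriples x y)) m)
          (l ∘ i.succAbove) := by
    intro i
    obtain ⟨s, u, hs, hu, hd⟩ := exists_det4_projection_eq (l i)
    have hli : ∀ k, (l ∘ i.succAbove) k ≠ l i := fun k => hl.ne (Fin.succAbove_ne i k)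
    rw [a3p_comp]
    refine altSum_congr fun k => altSum_congr fun j => ?_
    refine bracketR3_congr (s * u ((l ∘ i.succAbove) k)) u {a | a ≠ l i}
      (mul_ne_zero hs (hu _)) (fun a _ => hu a) ?_
      (fun a ha b hb c hc => by rw [hd _ _ _ _ (hli k) ha hb hc]; ring)
    intro t
    fin_cases t <;> first | exact hli _ | exact hm _ _
  rw [altSum_congr (H := fun e w => altSum (fun p x => altSum (fun _ y =>
    bracketR3 (fun a b c => det5 e.rep p.rep a.rep b.rep c.rep) (joinTriples x y)) m) w) hp]
  refine altSum_altSum_eq_zero (altSum_congr fun i => altSum_congr fun k => altSum_congr fun j => ?_)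
  exact bracketR3_congr (-1) (fun _ => 1) Set.univ (by simp) (by simp) (fun _ => trivial)
    (fun a _ b _ c _ => by rw [det5_swap01]; ring)

lemma sum_a3pp_projection_eq_zero (h : ∀ i : Fin 5, GenericPair
      (projection 3 (fun _ : Fin 1 => l i) ∘ (l ∘ i.succAbove))
      (projection 3 (fun _ : Fin 1 => l i) ∘ m)) :
    altSum (fun e w => a3pp (projection 3 (fun _ : Fin 1 => e) ∘ w)
      (projection 3 (fun _ : Fin 1 => e) ∘ m)) l = 0 := by
  have hl := left_injective_of_projection h
  have hm := left_ne_right_of_projection h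
  have hp : ∀ i : Fin 5, a3pp (projection 3 (fun _ : Fin 1 => l i) ∘ (l ∘ i.succAbove))
      (projection 3 (fun _ : Fin 1 => l i) ∘ m) = altSum (fun p x => altSum (fun q y =>
        mu3 (bracketCr fun a b => det5 (l i).rep p.rep q.rep a.rep b.rep) x y) m)
          (l ∘ i.succAbove) := by
    intro i
    obtain ⟨s, u, hs, hu, hd⟩ := exists_det4_projection_eq (l i)
    have hli : ∀ k, (l ∘ i.succAbove) k ≠ l i := fun k => hl.ne (Fin.succAbove_ne i k)
    rw [a3pp_comp]
    refine altSum_congr fun k => altSum_congr fun j => ?_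
    exact mu3_bracketCr_congr (s * u ((l ∘ i.succAbove) k) * u (m j)) u {a | a ≠ l i}
      (mul_ne_zero (mul_ne_zero hs (hu _)) (hu _)) (fun a _ => hu a)
      (fun a ha b hb => by rw [hd _ _ _ _ (hli k) (hm i j) ha hb]; ring)
      (fun t => hli _) (fun t => hm _ _)
  rw [altSum_congr (H := fun e w => altSum (fun p x => altSum (fun q y =>
    mu3 (bracketCr fun a b => det5 e.rep p.rep q.rep a.rep b.rep) x y) m) w) hp]
  refine altSum_altSum_eq_zero (altSum_congr fun i => altSum_congr fun k => altSum_congr fun j => ?_)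
  exact mu3_bracketCr_congr (-1) (fun _ => 1) Set.univ (by simp) (by simp)
    (fun a _ b _ => by rw [det5_swap01]; ring) (fun _ => trivial) (fun _ => trivial)

end DualAdditivity

/-- Proposition 3.3.  Both `a_3'` and `a_3''` send the relations
2) (skew-symmetry in the `l`'s and in the `m`'s), 3) (additivity and dual additivity in
`L` and in `M`) and 4) (projective invariance) defining `A_3(F)` to zero in `B_3(F) ⊗ ℚ`,
whenever all the occurring terms are generic. -/
theorem statement7 (F : Type) [Field F]
    (f : (Fin 4 → Pt F 4) → (Fin 4 → Pt F 4) → QF F) (hf : f = a3p ∨ f = a3pp) :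
    -- 2) skew-symmetry in L and in M
    (∀ (l m : Fin 4 → Pt F 4) (σ : Equiv.Perm (Fin 4)), GenericPair l m →
      clsB3 F (f (l ∘ σ) m) = (Equiv.Perm.sign σ : ℤ) • clsB3 F (f l m)) ∧
    (∀ (l m : Fin 4 → Pt F 4) (σ : Equiv.Perm (Fin 4)), GenericPair l m →
      clsB3 F (f l (m ∘ σ)) = (Equiv.Perm.sign σ : ℤ) • clsB3 F (f l m)) ∧
    -- 3) additivity in L and in M
    (∀ (l : Fin 5 → Pt F 4) (m : Fin 4 → Pt F 4),
      (∀ i : Fin 5, GenericPair (l ∘ i.succAbove) m) →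
      ∑ i : Fin 5, ((-1 : ℤ) ^ (i : ℕ)) • clsB3 F (f (l ∘ i.succAbove) m) = 0) ∧
    (∀ (l : Fin 4 → Pt F 4) (m : Fin 5 → Pt F 4),
      (∀ j : Fin 5, GenericPair l (m ∘ j.succAbove)) →
      ∑ j : Fin 5, ((-1 : ℤ) ^ (j : ℕ)) • clsB3 F (f l (m ∘ j.succAbove)) = 0) ∧
    -- 3̂) dual additivity in L and in M
    (∀ (l : Fin 5 → Pt F 5) (m : Fin 4 → Pt F 5),
      (∀ i : Fin 5, GenericPair
        (projection 3 (fun _ : Fin 1 => l i) ∘ (l ∘ i.succAbove))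
        (projection 3 (fun _ : Fin 1 => l i) ∘ m)) →
      ∑ i : Fin 5, ((-1 : ℤ) ^ (i : ℕ)) • clsB3 F
        (f (projection 3 (fun _ : Fin 1 => l i) ∘ (l ∘ i.succAbove))
           (projection 3 (fun _ : Fin 1 => l i) ∘ m)) = 0) ∧
    (∀ (l : Fin 4 → Pt F 5) (m : Fin 5 → Pt F 5),
      (∀ j : Fin 5, GenericPair
        (projection 3 (fun _ : Fin 1 => m j) ∘ l)
        (projection 3 (fun _ : Fin 1 => m j) ∘ (m ∘ j.succAbove))) →
      ∑ j : Fin 5, ((-1 : ℤ) ^ (j : ℕ)) • clsB3 F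
        (f (projection 3 (fun _ : Fin 1 => m j) ∘ l)
           (projection 3 (fun _ : Fin 1 => m j) ∘ (m ∘ j.succAbove))) = 0) ∧
    -- 4) projective invariance
    (∀ (l m : Fin 4 → Pt F 4) (g : (Fin 4 → F) ≃ₗ[F] (Fin 4 → F)), GenericPair l m →
      clsB3 F (f (mapPt g ∘ l) (mapPt g ∘ m)) = clsB3 F (f l m)) := by
  obtain ⟨hsymm, hskew, hadd, hdual, hproj⟩ :
      (∀ l m, GenericPair l m → clsB3 F (f l m) = clsB3 F (f m l)) ∧
      (∀ l m (σ : Equiv.Perm (Fin 4)), f (l ∘ σ) m = (Equiv.Perm.sign σ : ℤ) • f l m) ∧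
      (∀ (l : Fin 5 → Pt F 4) m, (∀ i : Fin 5, GenericPair (l ∘ i.succAbove) m) →
        altSum (fun _ x => clsB3 F (f x m)) l = 0) ∧
      (∀ (l : Fin 5 → Pt F 5) (m : Fin 4 → Pt F 5), (∀ i : Fin 5, GenericPair
          (projection 3 (fun _ : Fin 1 => l i) ∘ (l ∘ i.succAbove))
          (projection 3 (fun _ : Fin 1 => l i) ∘ m)) →
        altSum (fun e w => f (projection 3 (fun _ : Fin 1 => e) ∘ w)
          (projection 3 (fun _ : Fin 1 => e) ∘ m)) l = 0) ∧
      (∀ g l m, f (mapPt g ∘ l) (mapPt g ∘ m) = f l m) := by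
    rcases hf with rfl | rfl
    · exact ⟨fun _ _ => clsB3_a3p_comm, a3p_perm_left, fun _ _ => altSum_clsB3_a3p_eq_zero,
        fun _ _ => sum_a3p_projection_eq_zero, a3p_mapPt⟩
    · refine ⟨fun l m _ => by rw [a3pp_comm], a3pp_perm_left, fun l m _ => ?_,
        fun _ _ => sum_a3pp_projection_eq_zero, a3pp_mapPt⟩
      rw [← map_altSum, altSum_a3pp_eq_zero, map_zero]
  have hskew' : ∀ l m (σ : Equiv.Perm (Fin 4)),
      clsB3 F (f (l ∘ σ) m) = (Equiv.Perm.sign σ : ℤ) • clsB3 F (f l m) := by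
    intro l m σ
    rw [hskew, map_zsmul]
  have hdual' : ∀ (l : Fin 5 → Pt F 5) (m : Fin 4 → Pt F 5), (∀ i : Fin 5, GenericPair
        (projection 3 (fun _ : Fin 1 => l i) ∘ (l ∘ i.succAbove))
        (projection 3 (fun _ : Fin 1 => l i) ∘ m)) →
      altSum (fun e w => clsB3 F (f (projection 3 (fun _ : Fin 1 => e) ∘ w)
        (projection 3 (fun _ : Fin 1 => e) ∘ m))) l = 0 := by
    intro l m h
    rw [← map_altSum, hdual l m h, map_zero]
  refine ⟨fun l m σ _ => hskew' l m σ, fun l m σ h => ?_, hadd, fun l m h => ?_, hdual',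
    fun l m h => ?_, fun l m g _ => by rw [hproj]⟩
  · rw [← hsymm _ _ (h.symm.perm_left σ), hskew', hsymm _ _ h]
  · rw [← hadd m l fun j => (h j).symm]
    exact Finset.sum_congr rfl fun j _ => by rw [hsymm _ _ (h j)]
  · rw [← hdual' m l fun j => (h j).symm]
    exact Finset.sum_congr rfl fun j _ => by rw [hsymm _ _ (h j)]

end Gon
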